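/- There exists a universal constant C such that for every dimension d ≥ 1 and every vector ε = (ε_1, …, ε_d) ∈ ℝ^d with ε̄ := max_k |ε_k| ≤ 1/2, the centered Gaussian measures on ℝ^d with covariance I_d and with covariance diag(1+ε_1, …, 1+ε_d) satisfy sup_A |P(N(0, I_d) ∈ A) − P(N(0, diag(1+ε_1,…,1+ε_d)) ∈ A)| ≤ C · d · ε̄^{1/4}, where the supremum is over all measurable subsets A of ℝ^d. -/

import Mathlib

open MeasureTheory ProbabilityTheory

open scoped NNReal ENNReal

lemma MeasureTheory.Measure.pi_le_pi_of_le {ι : Type*} [Fintype ι] {α : ι → Type*}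
    [∀ i, MeasurableSpace (α i)] {μ ν : ∀ i, Measure (α i)} (h : ∀ i, μ i ≤ ν i) :
    Measure.pi μ ≤ Measure.pi ν := by
  refine Measure.le_iff.2 fun s hs => ?_
  rw [Measure.pi, Measure.pi, toMeasure_apply _ _ hs, toMeasure_apply _ _ hs]
  refine (OuterMeasure.le_pi.2 fun t _ => ?_ :
    OuterMeasure.pi (fun i => (μ i).toOuterMeasure) ≤
      OuterMeasure.pi (fun i => (ν i).toOuterMeasure)) s
  exact (OuterMeasure.pi_pi_le _ t).trans (Finset.prod_le_prod' fun i _ => h i (t i))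

lemma ProbabilityTheory.smul_gaussianReal_le_gaussianReal {v w : ℝ≥0} (hv : v ≠ 0)
    (hvw : v ≤ w) (m : ℝ) : (v / w) • gaussianReal m v ≤ gaussianReal m w := by
  have hw : w ≠ 0 := (hv.bot_lt.trans_le hvw).ne'
  have hv0 : (0 : ℝ) < v := by exact_mod_cast hv.bot_lt
  have hw0 : (0 : ℝ) < w := by exact_mod_cast hw.bot_lt
  have hvwR : (v : ℝ) ≤ w := by exact_mod_cast hvw
  have hpdf (x : ℝ) : (v / w : ℝ) * gaussianPDFReal m v x ≤ gaussianPDFReal m w x := by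
    have hcoef : (v / w : ℝ) * (√(2 * Real.pi * v))⁻¹ ≤ (√(2 * Real.pi * w))⁻¹ := by
      have hratio : (v / w : ℝ) ≤ √(v / w) :=
        Real.le_sqrt_of_sq_le (by
          have : (v / w : ℝ) ≤ 1 := (div_le_one hw0).2 hvwR
          nlinarith [div_pos hv0 hw0])
      calc (v / w : ℝ) * (√(2 * Real.pi * v))⁻¹
          ≤ √(v / w) * (√(2 * Real.pi * v))⁻¹ := by gcongr
        _ = (√(2 * Real.pi * w))⁻¹ := by
          rw [← Real.sqrt_inv, ← Real.sqrt_inv, ← Real.sqrt_mul (by positivity)]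
          congr 1
          field_simp
    have hexp : Real.exp (-(x - m) ^ 2 / (2 * v)) ≤ Real.exp (-(x - m) ^ 2 / (2 * w)) := by
      rw [neg_div, neg_div]
      gcongr
    simp only [gaussianPDFReal]
    rw [← mul_assoc]
    gcongr
  change ((v / w : ℝ≥0) : ℝ≥0∞) • gaussianReal m v ≤ _
  rw [gaussianReal_of_var_ne_zero m hv, gaussianReal_of_var_ne_zero m hw,
    ← withDensity_smul _ (measurable_gaussianPDF m v)]
  refine withDensity_mono (ae_of_all _ fun x => ?_)
  simp only [Pi.smul_apply, smul_eq_mul, gaussianPDF]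
  rw [← ENNReal.ofReal_coe_nnreal, ← ENNReal.ofReal_mul (by positivity)]
  exact ENNReal.ofReal_le_ofReal (by simpa using hpdf x)

/-- A common minorant of `N(m, v)` and `N(m, w)`, whose mass is the ratio of the smaller variance
to the larger one. -/
lemma ProbabilityTheory.exists_le_gaussianReal_and_le_gaussianReal {v w : ℝ≥0} (hv : v ≠ 0)
    (hw : w ≠ 0) (m : ℝ) :
    ∃ κ : Measure ℝ, IsFiniteMeasure κ ∧ κ ≤ gaussianReal m v ∧ κ ≤ gaussianReal m w ∧
      κ.real Set.univ = min v w / max v w := by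
  wlog hvw : v ≤ w generalizing v w
  · obtain ⟨κ, hfin, hκw, hκv, hmass⟩ := this hw hv (le_of_not_ge hvw)
    exact ⟨κ, hfin, hκv, hκw, by rw [hmass, min_comm, max_comm]⟩
  refine ⟨(v / w) • gaussianReal m v, inferInstance, ?_,
    smul_gaussianReal_le_gaussianReal hv hvw m, ?_⟩
  · refine Measure.le_iff.2 fun s _ => ?_
    rw [Measure.smul_apply]
    change ((v / w : ℝ≥0) : ℝ≥0∞) * _ ≤ _
    exact mul_le_of_le_one_left' (by exact_mod_cast div_le_one_of_le₀ hvw zero_le)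
  · rw [measureReal_nnreal_smul_apply]
    simp [hvw]

lemma MeasureTheory.abs_measureReal_sub_le_of_common_minorant {α : Type*} [MeasurableSpace α]
    {μ ν κ : Measure α} [IsProbabilityMeasure μ] [IsProbabilityMeasure ν]
    (hμ : κ ≤ μ) (hν : κ ≤ ν) {A : Set α} (hA : MeasurableSet A) :
    |μ.real A - ν.real A| ≤ 1 - κ.real Set.univ := by
  have : IsFiniteMeasure κ := isFiniteMeasure_of_le μ hμ
  have hκ := measureReal_add_measureReal_compl (μ := κ) hA
  have hμA := probReal_compl_eq_one_sub (μ := μ) hA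
  have hνA := probReal_compl_eq_one_sub (μ := ν) hA
  have key {ρ : Measure α} [IsProbabilityMeasure ρ] (h : κ ≤ ρ) (s : Set α) :
      κ.real s ≤ ρ.real s :=
    ENNReal.toReal_mono (measure_ne_top ρ s) (h s)
  rw [abs_le]
  constructor <;> linarith [key hμ A, key hν A, key hμ Aᶜ, key hν Aᶜ]

/-- There is a universal constant `C` such that for every `d ≥ 1` and every
`ε ∈ ℝ^d` with `ε̄ := max_k |ε_k| ≤ 1/2`, the centered Gaussian measures on `ℝ^d` with
covariance `I_d` and with covariance `diag(1+ε_1,…,1+ε_d)` differ by at most `C·d·ε̄^{1/4}` in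
total variation (supremum over all measurable sets). -/
theorem gaussian_diagonal_perturbation_total_variation_bound :
    ∃ C : ℝ, ∀ d : ℕ, 1 ≤ d → ∀ ε : Fin d → ℝ, (⨆ k, |ε k|) ≤ 1 / 2 →
      ∀ A : Set (Fin d → ℝ), MeasurableSet A →
        |((Measure.pi fun _ : Fin d => gaussianReal 0 1) A).toReal
            - ((Measure.pi fun i : Fin d => gaussianReal 0 (Real.toNNReal (1 + ε i))) A).toReal|
          ≤ C * d * (⨆ k, |ε k|) ^ ((1 : ℝ) / 4) := by
  refine ⟨1, fun d _ ε hε A hA => ?_⟩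
  set δ := ⨆ k, |ε k|
  have hδ0 : 0 ≤ δ := Real.iSup_nonneg fun k => abs_nonneg _
  have hle (k : Fin d) : |ε k| ≤ δ := le_ciSup (Set.finite_range fun k => |ε k|).bddAbove k
  have hpos (k : Fin d) : 0 < 1 + ε k := by linarith [neg_abs_le (ε k), hle k]
  choose κ hfin hκ₁ hκ₂ hmass using fun k => exists_le_gaussianReal_and_le_gaussianReal
    (one_ne_zero (α := ℝ≥0)) (Real.toNNReal_pos.2 (hpos k)).ne' 0
  have hmass_ge (k : Fin d) : 1 - δ ≤ (κ k).real Set.univ := by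
    rw [hmass k, NNReal.coe_min, NNReal.coe_max, Real.coe_toNNReal _ (hpos k).le, NNReal.coe_one]
    have := abs_le.1 (hle k)
    rcases le_total 1 (1 + ε k) with h | h
    · rw [min_eq_left h, max_eq_right h, le_div_iff₀ (hpos k)]
      nlinarith
    · rw [min_eq_right h, max_eq_left h]
      linarith
  have hpi : 1 - d * δ ≤ (Measure.pi κ).real Set.univ := by
    rw [measureReal_def, Measure.pi_univ, ENNReal.toReal_prod]
    calc 1 - d * δ = 1 + d * (-δ) := by ring
      _ ≤ (1 + -δ) ^ d := one_add_mul_le_pow (by linarith) d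
      _ = ∏ _k : Fin d, (1 - δ) := by simp [sub_eq_add_neg]
      _ ≤ _ := Finset.prod_le_prod (fun _ _ => by linarith) fun k _ => hmass_ge k
  calc _ ≤ 1 - (Measure.pi κ).real Set.univ :=
        abs_measureReal_sub_le_of_common_minorant (Measure.pi_le_pi_of_le hκ₁)
          (Measure.pi_le_pi_of_le hκ₂) hA
    _ ≤ d * δ := by linarith
    _ ≤ 1 * d * δ ^ ((1 : ℝ) / 4) := by
      rw [one_mul]
      gcongr
      exact Real.self_le_rpow_of_le_one hδ0 (by linarith) (by norm_num)
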